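/- Let τ > 0, let x : [0,τ] → ℝ be continuous, and let m : [τ,∞) → ℝ be twice continuously differentiable and satisfy the ODE t m''(t) + (1+t) m'(t) − m(t) = 0 for all t ≥ τ, with boundary conditions m(τ) = x(τ) and m'(τ) = −x(τ) + (2/τ)∫_0^τ x(u) du. Then for all t ≥ τ, m(t) = (1+t)·( x(τ)/(1+τ) + C ∫_τ^t e^{−y}/(y(1+y)²) dy ), where the constant C is determined by C e^{−τ}/(τ(1+τ)) + ((2+τ)/(1+τ)) x(τ) = (2/τ)∫_0^τ x(u) du. In particular, if instead τ = 0 and the solution is regular at 0 with m(0) = 1, then m(t) = 1 + t for all t ≥ 0. -/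

import Mathlib

open MeasureTheory Filter Real intervalIntegral

/-- A function with vanishing derivative on `[a, ∞)` is constant there. -/
lemma eq_of_hasDerivAt_zero_Ici {f : ℝ → ℝ} {a : ℝ} (hf : ∀ t, a ≤ t → HasDerivAt f 0 t)
    {t : ℝ} (ht : a ≤ t) : f t = f a :=
  constant_of_has_deriv_right_zero
    (fun s hs => (hf s hs.1).continuousAt.continuousWithinAt)
    (fun s hs => (hf s hs.1).hasDerivWithinAt) t ⟨ht, le_rfl⟩

/-- First integral of `t m'' + (1 + t) m' - m = 0`. -/
lemma mean_ode_first_integral {a : ℝ} {m m' m'' : ℝ → ℝ}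
    (hm : ∀ t, a ≤ t → HasDerivAt m (m' t) t)
    (hm' : ∀ t, a ≤ t → HasDerivAt m' (m'' t) t)
    (hode : ∀ t, a ≤ t → t * m'' t + (1 + t) * m' t - m t = 0) {t : ℝ} (ht : a ≤ t) :
    t * Real.exp t * ((1 + t) * m' t - m t) = a * Real.exp a * ((1 + a) * m' a - m a) := by
  refine eq_of_hasDerivAt_zero_Ici
    (f := fun t => t * Real.exp t * ((1 + t) * m' t - m t)) (fun s hs => ?_) ht
  have h := ((hasDerivAt_id s).mul (Real.hasDerivAt_exp s)).mul
    ((((hasDerivAt_id s).const_add 1).mul (hm' s hs)).sub (hm s hs))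
  refine h.congr_deriv ?_
  simp only [id, Pi.mul_apply, Pi.sub_apply]
  linear_combination Real.exp s * (1 + s) * hode s hs

lemma hasDerivAt_div_one_add {m : ℝ → ℝ} {d t : ℝ} (hm : HasDerivAt m d t) (ht : 1 + t ≠ 0) :
    HasDerivAt (fun s => m s / (1 + s)) (((1 + t) * d - m t) / (1 + t) ^ 2) t := by
  refine (hm.div ((hasDerivAt_id t).const_add 1) ht).congr_deriv ?_
  simp only [id]
  ring

/-- Solution of the mean ODE `t m'' + (1+t) m' − m = 0` of the continuized adding
process.  For `τ > 0` with the stated boundary conditions,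
`m(t) = (1+t)(x(τ)/(1+τ) + C ∫_τ^t e^{−y}/(y(1+y)²) dy)` where `C` satisfies
`C e^{−τ}/(τ(1+τ)) + ((2+τ)/(1+τ)) x(τ) = (2/τ)∫_0^τ x`.  In particular for `τ = 0`
with the solution regular at `0` and `m(0) = 1`, `m(t) = 1 + t`. -/
theorem continuized_mean :
    (∀ (τ : ℝ), 0 < τ → ∀ (x m m' m'' : ℝ → ℝ),
      ContinuousOn x (Set.Icc 0 τ) →
      (∀ t, τ ≤ t → HasDerivAt m (m' t) t) →
      (∀ t, τ ≤ t → HasDerivAt m' (m'' t) t) →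
      (∀ t, τ ≤ t → t * m'' t + (1 + t) * m' t - m t = 0) →
      m τ = x τ →
      m' τ = -x τ + (2 / τ) * ∫ u in (0:ℝ)..τ, x u →
      ∃ C : ℝ,
        C * Real.exp (-τ) / (τ * (1 + τ)) + ((2 + τ) / (1 + τ)) * x τ =
          (2 / τ) * ∫ u in (0:ℝ)..τ, x u ∧
        ∀ t, τ ≤ t →
          m t = (1 + t) *
            (x τ / (1 + τ) + C * ∫ y in τ..t, Real.exp (-y) / (y * (1 + y) ^ 2))) ∧
    (∀ (m m' m'' : ℝ → ℝ),
      (∀ t, (0:ℝ) ≤ t → HasDerivAt m (m' t) t) →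
      (∀ t, (0:ℝ) ≤ t → HasDerivAt m' (m'' t) t) →
      (∀ t, (0:ℝ) ≤ t → t * m'' t + (1 + t) * m' t - m t = 0) →
      m 0 = 1 →
      ∀ t, (0:ℝ) ≤ t → m t = 1 + t) := by
  refine ⟨?_, ?_⟩
  · intro τ hτ x m m' m'' _ hm hm' hode hx hx'
    have hτ1 : 1 + τ ≠ 0 := by positivity
    refine ⟨τ * Real.exp τ * ((1 + τ) * m' τ - m τ), ?_, fun t ht => ?_⟩
    · rw [Real.exp_neg, hx]
      have hI : (2 / τ) * ∫ u in (0:ℝ)..τ, x u = m' τ + x τ := by linarith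
      rw [hI]
      have := Real.exp_ne_zero τ
      field_simp
      ring
    · have hint : ∫ y in τ..t, (τ * Real.exp τ * ((1 + τ) * m' τ - m τ)) *
          (Real.exp (-y) / (y * (1 + y) ^ 2)) = m t / (1 + t) - m τ / (1 + τ) := by
        refine integral_eq_sub_of_hasDerivAt (f := fun s => m s / (1 + s)) (fun y hy => ?_) ?_
        · rw [Set.uIcc_of_le ht] at hy
          have hy0 : 0 < y := hτ.trans_le hy.1
          have hy1 : 1 + y ≠ 0 := by positivity
          refine (hasDerivAt_div_one_add (hm y hy.1) hy1).congr_deriv ?_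
          rw [← mean_ode_first_integral hm hm' hode hy.1, Real.exp_neg]
          have := Real.exp_ne_zero y
          field_simp
        · refine ContinuousOn.intervalIntegrable fun y hy => ContinuousAt.continuousWithinAt ?_
          rw [Set.uIcc_of_le ht] at hy
          have hy0 : 0 < y := hτ.trans_le hy.1
          have hy1 : y * (1 + y) ^ 2 ≠ 0 := by positivity
          fun_prop (disch := assumption)
      rw [← intervalIntegral.integral_const_mul, hint, hx]
      have ht1 : 1 + t ≠ 0 := by linarith
      field_simp
      ring
  · intro m m' m'' hm hm' hode h0 t ht
    have hW : ∀ s, 0 ≤ s → (1 + s) * m' s - m s = 0 := by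
      intro s hs
      rcases hs.eq_or_lt with rfl | hs'
      · linarith [hode 0 le_rfl]
      · have h := mean_ode_first_integral hm hm' hode hs
        rw [zero_mul, zero_mul] at h
        exact (mul_eq_zero.mp h).resolve_left (by positivity)
    have h : m t / (1 + t) = m 0 / (1 + 0) := by
      refine eq_of_hasDerivAt_zero_Ici (f := fun s => m s / (1 + s)) (fun s hs => ?_) ht
      refine (hasDerivAt_div_one_add (hm s hs) (by positivity)).congr_deriv ?_
      rw [hW s hs, zero_div]
    have ht1 : 1 + t ≠ 0 := by positivity
    rw [h0, div_eq_iff ht1] at h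
    linarith
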